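/- Suppose there exists N such that A^n = 0 for all n > N, and suppose Ω^n ⊆ G^n for every n (i.e., G = Ω). Let ℝ(u) denote the field of fractions of the polynomial ring ℝ[u]. Then the localization of the equivariant cohomology vanishes: H^*(C) ⊗_{ℝ[u]} ℝ(u) = 0, where H^*(C) carries the ℝ[u]-module structure induced by u·((α,β)⊗u^j) = (α,β)⊗u^{j+1}. -/

import Mathlib

/-!
Common algebraic model for the paper "Intersection cohomology of circle actions"
(Padilla–Saralegi), following the CONTEXT of the statements.

`A` models the (total space of the) graded-commutative differential graded ℝ-algebra
`A = ⊕ₙ Aⁿ` of liftable forms on the orbit space `B`; the grading is only recorded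
through the families of graded subspaces `P Q : ℤ → Submodule ℝ A` (the forms of
perverse degree `≤ p̄` resp. `≤ p̄ - x̄`), which vanish in negative degrees
(`Aⁿ = 0` for `n < 0`).  The differential is `d` with `d ∘ d = 0`, and
`e : A →ₗ[ℝ] A` is right multiplication by the fixed Euler form `ε ∈ A²`;
the hypotheses `dε = 0` together with the graded Leibniz rule amount exactly to
the commutation `d ∘ e = e ∘ d`, which is how we encode them.
-/

open Submodule LinearMap

noncomputable section

namespace IG

variable {A : Type*} [AddCommGroup A] [Module ℝ A]

/-- `Ω^n = {α ∈ P^n : dα ∈ P^(n+1)}`. -/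
def Om (d : A →ₗ[ℝ] A) (P : ℤ → Submodule ℝ A) (n : ℤ) : Submodule ℝ A :=
  P n ⊓ (P (n + 1)).comap d

/-- First component of `D` in degree `n` : `(α, β) ↦ dα + (-1)^(n-1) β∧ε`. -/
def D1 (d e : A →ₗ[ℝ] A) (n : ℤ) : A × A →ₗ[ℝ] A :=
  d ∘ₗ LinearMap.fst ℝ A A + ((-1 : ℝ) ^ (n - 1)) • (e ∘ₗ LinearMap.snd ℝ A A)

/-- `D(α,β) = (dα + (-1)^(n-1) β∧ε, dβ)` in degree `n`. -/
def Dmap (d e : A →ₗ[ℝ] A) (n : ℤ) : A × A →ₗ[ℝ] A × A :=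
  (D1 d e n).prod (d ∘ₗ LinearMap.snd ℝ A A)

/-- `K^n = {(α,β) ∈ P^n × Q^(n-1) : dβ ∈ Q^n, dα + (-1)^(n-1) β∧ε ∈ P^(n+1)}`. -/
def Ksub (d e : A →ₗ[ℝ] A) (P Q : ℤ → Submodule ℝ A) (n : ℤ) : Submodule ℝ (A × A) :=
  (P n).comap (LinearMap.fst ℝ A A) ⊓ (Q (n - 1)).comap (LinearMap.snd ℝ A A) ⊓
    (Q n).comap (d ∘ₗ LinearMap.snd ℝ A A) ⊓ (P (n + 1)).comap (D1 d e n)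

/-- `G^n = {β ∈ Q^n : dβ ∈ Q^(n+1), ∃ α ∈ P^(n+1), dα + (-1)^n β∧ε ∈ P^(n+2)}`. -/
def Gsub (d e : A →ₗ[ℝ] A) (P Q : ℤ → Submodule ℝ A) (n : ℤ) : Submodule ℝ A :=
  Q n ⊓ (Q (n + 1)).comap d ⊓
    (((P (n + 1)).comap (LinearMap.fst ℝ A A) ⊓
        (P (n + 2)).comap
          (d ∘ₗ LinearMap.fst ℝ A A + ((-1 : ℝ) ^ n) • (e ∘ₗ LinearMap.snd ℝ A A))).map
      (LinearMap.snd ℝ A A))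

/-- `C^m = ⊕_{i+2j=m} K^i ⊗ ℝ·u^j`, realized as the functions `ω : ℕ → A × A`
(`ω j` = the coefficient of `u^j`) with `ω j ∈ K^(m-2j)` for all `j`. -/
def Csub (d e : A →ₗ[ℝ] A) (P Q : ℤ → Submodule ℝ A) (m : ℤ) : Submodule ℝ (ℕ → A × A) :=
  ⨅ j : ℕ, (Ksub d e P Q (m - 2 * (j : ℤ))).comap (LinearMap.proj (R := ℝ) j)

/-- `∇((α,β) ⊗ u^j) = D(α,β) ⊗ u^j + (-1)^(n-1) (β,0) ⊗ u^(j+1)` on total degree `m`. -/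
def nabla (d e : A →ₗ[ℝ] A) (m : ℤ) : (ℕ → A × A) →ₗ[ℝ] (ℕ → A × A) :=
  LinearMap.pi fun j : ℕ =>
    Dmap d e (m - 2 * (j : ℤ)) ∘ₗ LinearMap.proj j +
      if j = 0 then 0
      else ((-1 : ℝ) ^ (m - 2 * ((j : ℤ) - 1) - 1)) •
        (LinearMap.inl ℝ A A ∘ₗ LinearMap.snd ℝ A A ∘ₗ LinearMap.proj (j - 1))

/-- Multiplication by `u` (degree 2) on an `ℝ[u]`-module realized as `ℕ → M`. -/
def shiftL (M : Type*) [AddCommGroup M] [Module ℝ M] : (ℕ → M) →ₗ[ℝ] (ℕ → M) :=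
  LinearMap.pi fun j : ℕ => if j = 0 then 0 else LinearMap.proj (j - 1)

/-- `π' (α ⊗ u^j) = (α, 0) ⊗ u^j`. -/
def piMap : (ℕ → A) →ₗ[ℝ] ℕ → A × A :=
  LinearMap.pi fun j : ℕ => LinearMap.inl ℝ A A ∘ₗ LinearMap.proj j

/-- `∮' ((α,β) ⊗ u^j) = β ⊗ u^j`. -/
def ointMap : (ℕ → A × A) →ₗ[ℝ] ℕ → A :=
  LinearMap.pi fun j : ℕ => LinearMap.snd ℝ A A ∘ₗ LinearMap.proj j

/-- `d ⊗ 1`. -/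
def dpi (d : A →ₗ[ℝ] A) : (ℕ → A) →ₗ[ℝ] ℕ → A :=
  LinearMap.pi fun j : ℕ => d ∘ₗ LinearMap.proj j

/-- `(Ω ⊗ ℝ[u])^m`. -/
def OmC (d : A →ₗ[ℝ] A) (P : ℤ → Submodule ℝ A) (m : ℤ) : Submodule ℝ (ℕ → A) :=
  ⨅ j : ℕ, (Om d P (m - 2 * (j : ℤ))).comap (LinearMap.proj (R := ℝ) j)

/-- `(G[-1] ⊗ ℝ[u])^m` (`G[-1]` places `G^n` in degree `n+1`). -/
def GCs (d e : A →ₗ[ℝ] A) (P Q : ℤ → Submodule ℝ A) (m : ℤ) : Submodule ℝ (ℕ → A) :=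
  ⨅ j : ℕ, (Gsub d e P Q (m - 1 - 2 * (j : ℤ))).comap (LinearMap.proj (R := ℝ) j)

/-- Cohomology presented as (cocycles) / (coboundaries). -/
abbrev Hq {M : Type*} [AddCommGroup M] [Module ℝ M] (Z B : Submodule ℝ M) :=
  Z ⧸ (B.comap Z.subtype)

/-- Cocycles of `Ω`. -/
def ZOm (d : A →ₗ[ℝ] A) (P : ℤ → Submodule ℝ A) (n : ℤ) : Submodule ℝ A :=
  Om d P n ⊓ LinearMap.ker d

/-- Coboundaries of `Ω`. -/
def BOm (d : A →ₗ[ℝ] A) (P : ℤ → Submodule ℝ A) (n : ℤ) : Submodule ℝ A :=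
  (Om d P (n - 1)).map d

/-- `H^n(Ω)`. -/
abbrev HOm (d : A →ₗ[ℝ] A) (P : ℤ → Submodule ℝ A) (n : ℤ) :=
  Hq (ZOm d P n) (BOm d P n)

/-- Cocycles of `G`. -/
def ZG (d e : A →ₗ[ℝ] A) (P Q : ℤ → Submodule ℝ A) (n : ℤ) : Submodule ℝ A :=
  Gsub d e P Q n ⊓ LinearMap.ker d

/-- Coboundaries of `G`. -/
def BG (d e : A →ₗ[ℝ] A) (P Q : ℤ → Submodule ℝ A) (n : ℤ) : Submodule ℝ A :=
  (Gsub d e P Q (n - 1)).map d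

/-- `H^n(G)`. -/
abbrev HG (d e : A →ₗ[ℝ] A) (P Q : ℤ → Submodule ℝ A) (n : ℤ) :=
  Hq (ZG d e P Q n) (BG d e P Q n)

/-- The co-Gysin space `𝒦^n = Ω^n / G^n` (cochain level). -/
abbrev Kq (d e : A →ₗ[ℝ] A) (P Q : ℤ → Submodule ℝ A) (n : ℤ) :=
  (Om d P n) ⧸ ((Gsub d e P Q n).comap (Om d P n).subtype)

/-- Cocycles of the co-Gysin complex `𝒦 = Ω/G`, presented by representatives:
`α ∈ Ω^n` with `dα ∈ G^(n+1)`. -/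
def ZKo (d e : A →ₗ[ℝ] A) (P Q : ℤ → Submodule ℝ A) (n : ℤ) : Submodule ℝ A :=
  Om d P n ⊓ (Gsub d e P Q (n + 1)).comap d

/-- Representatives of coboundaries of `𝒦 = Ω/G`. -/
def BKo (d e : A →ₗ[ℝ] A) (P Q : ℤ → Submodule ℝ A) (n : ℤ) : Submodule ℝ A :=
  Gsub d e P Q n ⊔ (Om d P (n - 1)).map d

/-- `H^n(𝒦)`. -/
abbrev HKo (d e : A →ₗ[ℝ] A) (P Q : ℤ → Submodule ℝ A) (n : ℤ) :=
  Hq (ZKo d e P Q n) (BKo d e P Q n)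

/-- Cocycles of `(C, ∇)`. -/
def ZC (d e : A →ₗ[ℝ] A) (P Q : ℤ → Submodule ℝ A) (m : ℤ) : Submodule ℝ (ℕ → A × A) :=
  Csub d e P Q m ⊓ LinearMap.ker (nabla d e m)

/-- Coboundaries of `(C, ∇)`. -/
def BC (d e : A →ₗ[ℝ] A) (P Q : ℤ → Submodule ℝ A) (m : ℤ) : Submodule ℝ (ℕ → A × A) :=
  (Csub d e P Q (m - 1)).map (nabla d e (m - 1))

/-- `H^m(C)`, the equivariant intersection cohomology. -/
abbrev HC (d e : A →ₗ[ℝ] A) (P Q : ℤ → Submodule ℝ A) (m : ℤ) :=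
  Hq (ZC d e P Q m) (BC d e P Q m)

/-- Cocycles of `(Ω ⊗ ℝ[u], d ⊗ 1)`. -/
def ZOmC (d : A →ₗ[ℝ] A) (P : ℤ → Submodule ℝ A) (m : ℤ) : Submodule ℝ (ℕ → A) :=
  OmC d P m ⊓ LinearMap.ker (dpi d)

/-- Coboundaries of `(Ω ⊗ ℝ[u], d ⊗ 1)`. -/
def BOmC (d : A →ₗ[ℝ] A) (P : ℤ → Submodule ℝ A) (m : ℤ) : Submodule ℝ (ℕ → A) :=
  (OmC d P (m - 1)).map (dpi d)

/-- `[H(Ω) ⊗ ℝ[u]]^m`, as the cohomology of the complex `(Ω ⊗ ℝ[u], d ⊗ 1)`. -/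
abbrev HOmCq (d : A →ₗ[ℝ] A) (P : ℤ → Submodule ℝ A) (m : ℤ) :=
  Hq (ZOmC d P m) (BOmC d P m)

/-- Cocycles of `(G[-1] ⊗ ℝ[u], d ⊗ 1)`. -/
def ZGC (d e : A →ₗ[ℝ] A) (P Q : ℤ → Submodule ℝ A) (m : ℤ) : Submodule ℝ (ℕ → A) :=
  GCs d e P Q m ⊓ LinearMap.ker (dpi d)

/-- Coboundaries of `(G[-1] ⊗ ℝ[u], d ⊗ 1)`. -/
def BGC (d e : A →ₗ[ℝ] A) (P Q : ℤ → Submodule ℝ A) (m : ℤ) : Submodule ℝ (ℕ → A) :=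
  (GCs d e P Q (m - 1)).map (dpi d)

/-- `[H(G) ⊗ ℝ[u]]^(m-1)`, as the cohomology of `(G[-1] ⊗ ℝ[u], d ⊗ 1)` in degree `m`. -/
abbrev HGCq (d e : A →ₗ[ℝ] A) (P Q : ℤ → Submodule ℝ A) (m : ℤ) :=
  Hq (ZGC d e P Q m) (BGC d e P Q m)

/-- The subspace of `ω : ℕ → A × A` supported in (filtration) degrees `≥ i`
(for total degree `m`): `ω j = 0` whenever `m - 2j < i`. -/
def Supp (i m : ℤ) : Submodule ℝ (ℕ → A × A) :=
  ⨅ (j : ℕ) (_ : m - 2 * (j : ℤ) < i),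
    LinearMap.ker (LinearMap.proj (R := ℝ) (φ := fun _ : ℕ => A × A) j)

/-- The filtration `F^i C^m = {ω ∈ ⊕_{i'≥i} K^{i'} ⊗ ℝ[u] of total degree m :
∇ω ∈ ⊕_{i'≥i} K^{i'} ⊗ ℝ[u]}`. -/
def FC (d e : A →ₗ[ℝ] A) (P Q : ℤ → Submodule ℝ A) (i m : ℤ) : Submodule ℝ (ℕ → A × A) :=
  Csub d e P Q m ⊓ Supp i m ⊓ (Supp i (m + 1)).comap (nabla d e m)

/-- `Z_r^{i,j} = F^i C^(i+j) ∩ ∇⁻¹(F^(i+r) C^(i+j+1))`. -/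
def Zsp (d e : A →ₗ[ℝ] A) (P Q : ℤ → Submodule ℝ A) (r i j : ℤ) : Submodule ℝ (ℕ → A × A) :=
  FC d e P Q i (i + j) ⊓ (FC d e P Q (i + r) (i + j + 1)).comap (nabla d e (i + j))

/-- `B_r^{i,j} = F^i C^(i+j) ∩ ∇(F^(i-r) C^(i+j-1))`. -/
def Bsp (d e : A →ₗ[ℝ] A) (P Q : ℤ → Submodule ℝ A) (r i j : ℤ) : Submodule ℝ (ℕ → A × A) :=
  FC d e P Q i (i + j) ⊓ (FC d e P Q (i - r) (i + j - 1)).map (nabla d e (i + j - 1))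

/-- `E_r^{i,j} = Z_r^{i,j} / (Z_(r-1)^{i+1,j-1} + B_(r-1)^{i,j})`. -/
abbrev Esp (d e : A →ₗ[ℝ] A) (P Q : ℤ → Submodule ℝ A) (r i j : ℤ) :=
  Zsp d e P Q r i j ⧸
    ((Zsp d e P Q (r - 1) (i + 1) (j - 1) ⊔ Bsp d e P Q (r - 1) i j).comap
      (Zsp d e P Q r i j).subtype)

/-- The differential `d_r : E_r^{i,j} → E_r^{i+r,j-r+1}` is the map induced by `∇`
(the target indices `(i', j')` are given freely, to be instantiated by
expressions equal to `(i + r, j - r + 1)`). -/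
def DrChar (d e : A →ₗ[ℝ] A) (P Q : ℤ → Submodule ℝ A) (r i j i' j' : ℤ)
    (dr : Esp d e P Q r i j →ₗ[ℝ] Esp d e P Q r i' j') : Prop :=
  ∀ (ω : ℕ → A × A) (hω : ω ∈ Zsp d e P Q r i j)
    (hω' : nabla d e (i + j) ω ∈ Zsp d e P Q r i' j'),
    dr (Submodule.Quotient.mk ⟨ω, hω⟩) = Submodule.Quotient.mk ⟨nabla d e (i + j) ω, hω'⟩

/-- `α ↦ (α, 0) ⊗ u^0 = (α,0) ⊗ 1`. -/
def embL : A →ₗ[ℝ] ℕ → A × A :=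
  LinearMap.single ℝ (fun _ : ℕ => A × A) 0 ∘ₗ LinearMap.inl ℝ A A

/-- `ι̃ : H^n(G) → H^{n'}(Ω)` induced by the inclusion `G ⊆ Ω` (`n' = n`). -/
def iotaChar (d e : A →ₗ[ℝ] A) (P Q : ℤ → Submodule ℝ A) (n n' : ℤ)
    (ι : HG d e P Q n →ₗ[ℝ] HOm d P n') : Prop :=
  ∀ (β : A) (hβ : β ∈ ZG d e P Q n) (hβ' : β ∈ ZOm d P n'),
    ι (Submodule.Quotient.mk ⟨β, hβ⟩) = Submodule.Quotient.mk ⟨β, hβ'⟩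

/-- `𝕖 : H^n(G) → H^{n'}(Ω)`, `𝕖[β] = [dα + (-1)^n β∧ε]` for any witness `α`
(`n' = n + 2`). -/
def eulerChar (d e : A →ₗ[ℝ] A) (P Q : ℤ → Submodule ℝ A) (n n' : ℤ)
    (E : HG d e P Q n →ₗ[ℝ] HOm d P n') : Prop :=
  ∀ (β : A) (hβ : β ∈ ZG d e P Q n) (α : A) (_ : α ∈ P (n + 1))
    (hz : d α + ((-1 : ℝ) ^ n) • e β ∈ ZOm d P n'),
    E (Submodule.Quotient.mk ⟨β, hβ⟩) =
      Submodule.Quotient.mk ⟨d α + ((-1 : ℝ) ^ n) • e β, hz⟩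

/-- `∂ : H^n(𝒦) → H^{n'}(G)`, `∂[ᾱ] = [dα]` (`n' = n + 1`). -/
def partialChar (d e : A →ₗ[ℝ] A) (P Q : ℤ → Submodule ℝ A) (n n' : ℤ)
    (pd : HKo d e P Q n →ₗ[ℝ] HG d e P Q n') : Prop :=
  ∀ (α : A) (hα : α ∈ ZKo d e P Q n) (hd : d α ∈ ZG d e P Q n'),
    pd (Submodule.Quotient.mk ⟨α, hα⟩) = Submodule.Quotient.mk ⟨d α, hd⟩

/-- `Pr : H^n(Ω) → H^{n'}(𝒦)` induced by the projection `Ω → 𝒦 = Ω/G` (`n' = n`). -/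
def prChar (d e : A →ₗ[ℝ] A) (P Q : ℤ → Submodule ℝ A) (n n' : ℤ)
    (pr : HOm d P n →ₗ[ℝ] HKo d e P Q n') : Prop :=
  ∀ (α : A) (hα : α ∈ ZOm d P n) (hα' : α ∈ ZKo d e P Q n'),
    pr (Submodule.Quotient.mk ⟨α, hα⟩) = Submodule.Quotient.mk ⟨α, hα'⟩

lemma neg_one_zpow_sub_two_mul (m j : ℤ) : (-1 : ℝ) ^ (m - 2 * j) = (-1) ^ m := by
  rw [zpow_sub₀ (by norm_num), (even_two_mul j).neg_one_zpow, div_one]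

lemma neg_one_zpow_sub_one (m : ℤ) : (-1 : ℝ) ^ (m - 1) = -(-1) ^ m := by
  rw [zpow_sub_one₀ (by norm_num)]
  norm_num

lemma neg_one_zpow_smul_smul (m : ℤ) (x : A) : ((-1 : ℝ) ^ m) • ((-1 : ℝ) ^ m) • x = x := by
  rw [smul_smul, ← mul_zpow]
  norm_num

lemma Dmap_sub_two_mul_apply (d e : A →ₗ[ℝ] A) (m j : ℤ) (x : A × A) :
    Dmap d e (m - 2 * j) x = (d x.1 - ((-1 : ℝ) ^ m) • e x.2, d x.2) := by
  have hs : (-1 : ℝ) ^ (m - 2 * j - 1) = -(-1) ^ m := by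
    rw [neg_one_zpow_sub_one, neg_one_zpow_sub_two_mul]
  simp [Dmap, D1, hs, ← sub_eq_add_neg]

lemma nabla_apply_zero (d e : A →ₗ[ℝ] A) (m : ℤ) (ω : ℕ → A × A) :
    nabla d e m ω 0 = (d (ω 0).1 - ((-1 : ℝ) ^ m) • e (ω 0).2, d (ω 0).2) := by
  simpa [nabla] using Dmap_sub_two_mul_apply d e m 0 (ω 0)

lemma nabla_apply_succ (d e : A →ₗ[ℝ] A) (m : ℤ) (ω : ℕ → A × A) (j : ℕ) :
    nabla d e m ω (j + 1) =
      (d (ω (j + 1)).1 - ((-1 : ℝ) ^ m) • e (ω (j + 1)).2 - ((-1 : ℝ) ^ m) • (ω j).2,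
        d (ω (j + 1)).2) := by
  have h : nabla d e m ω (j + 1) = Dmap d e (m - 2 * ((j + 1 : ℕ) : ℤ)) (ω (j + 1)) +
      ((-1 : ℝ) ^ (m - 2 * (((j + 1 : ℕ) : ℤ) - 1) - 1)) • ((ω j).2, (0 : A)) := by
    simp [nabla]
  rw [h, Dmap_sub_two_mul_apply, neg_one_zpow_sub_one, neg_one_zpow_sub_two_mul]
  simp [sub_eq_add_neg]

lemma mem_Ksub_sub_two_mul {d e : A →ₗ[ℝ] A} {P Q : ℤ → Submodule ℝ A} {m j : ℤ} {x : A × A} :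
    x ∈ Ksub d e P Q (m - 2 * j) ↔
      x.1 ∈ P (m - 2 * j) ∧ x.2 ∈ Q (m - 2 * j - 1) ∧ d x.2 ∈ Q (m - 2 * j) ∧
        d x.1 - ((-1 : ℝ) ^ m) • e x.2 ∈ P (m - 2 * j + 1) := by
  have hs : (-1 : ℝ) ^ (m - 2 * j - 1) = -(-1) ^ m := by
    rw [neg_one_zpow_sub_one, neg_one_zpow_sub_two_mul]
  simp [Ksub, D1, hs, ← sub_eq_add_neg, and_assoc]

lemma mem_Csub {d e : A →ₗ[ℝ] A} {P Q : ℤ → Submodule ℝ A} {m : ℤ} {ω : ℕ → A × A} :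
    ω ∈ Csub d e P Q m ↔ ∀ j : ℕ, ω j ∈ Ksub d e P Q (m - 2 * (j : ℤ)) := by
  simp [Csub]

lemma shiftL_mem_ZC {d e : A →ₗ[ℝ] A} {P Q : ℤ → Submodule ℝ A} {m : ℤ} {ω : ℕ → A × A}
    (hω : ω ∈ ZC d e P Q m) : shiftL (A × A) ω ∈ ZC d e P Q (m + 2) := by
  have h0 : shiftL (A × A) ω 0 = 0 := by simp [shiftL]
  have hs (j : ℕ) : shiftL (A × A) ω (j + 1) = ω j := by simp [shiftL]
  have hc : (-1 : ℝ) ^ (m + 2) = (-1) ^ m := by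
    simpa using neg_one_zpow_sub_two_mul m (-1)
  obtain ⟨hC, hker⟩ := hω
  rw [SetLike.mem_coe, LinearMap.mem_ker] at hker
  refine ⟨mem_Csub.2 fun j => ?_, LinearMap.mem_ker.2 (funext fun j => ?_)⟩
  · cases j with
    | zero => rw [h0]; exact zero_mem _
    | succ j =>
      rw [hs]
      convert mem_Csub.1 hC j using 2
      push_cast
      ring
  · rcases j with _ | _ | j
    · rw [nabla_apply_zero, h0]; simp
    · rw [nabla_apply_succ, h0, hs, hc]
      simpa [nabla_apply_zero] using congrFun hker 0
    · rw [nabla_apply_succ, hs, hs, hc, ← nabla_apply_succ]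
      exact congrFun hker (j + 1)

lemma iterate_shiftL_mem_ZC {d e : A →ₗ[ℝ] A} {P Q : ℤ → Submodule ℝ A} {m : ℤ}
    {ω : ℕ → A × A} (hω : ω ∈ ZC d e P Q m) (k : ℕ) :
    (shiftL (A × A))^[k] ω ∈ ZC d e P Q (m + 2 * (k : ℤ)) := by
  induction k with
  | zero => simpa using hω
  | succ k ih =>
    rw [Function.iterate_succ_apply']
    convert shiftL_mem_ZC ih using 2
    push_cast
    ring

/-- Every `x ∈ Ω^n` is the second component of an element of `K^(n+1)`. -/
lemma exists_correction {d e : A →ₗ[ℝ] A} {P Q : ℤ → Submodule ℝ A}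
    (hOG : ∀ n : ℤ, Om d P n ≤ Gsub d e P Q n) {n : ℤ} {x : A} (hx : x ∈ Om d P n) :
    ∃ a ∈ P (n + 1), d a + ((-1 : ℝ) ^ n) • e x ∈ P (n + 2) := by
  obtain ⟨-, ⟨a, x'⟩, ⟨h1, h2⟩, rfl⟩ := hOG n hx
  exact ⟨a, h1, h2⟩

/-- If `G = Ω`, every cocycle whose degree exceeds that of every nonzero form is a coboundary. -/
lemma ZC_le_BC_of_eq_bot {d e : A →ₗ[ℝ] A} (hd : d ∘ₗ d = 0) (hde : d ∘ₗ e = e ∘ₗ d)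
    {P Q : ℤ → Submodule ℝ A} (hQP : ∀ n, Q n ≤ P n)
    (hPneg : ∀ n : ℤ, n < 0 → P n = ⊥) (hQneg : ∀ n : ℤ, n < 0 → Q n = ⊥)
    (hOG : ∀ n : ℤ, Om d P n ≤ Gsub d e P Q n) {m : ℤ} (hm : P m = ⊥) :
    ZC d e P Q m ≤ BC d e P Q m := by
  intro ω hω
  obtain ⟨hC, hker⟩ := hω
  rw [SetLike.mem_coe, LinearMap.mem_ker] at hker
  have hK (j : ℕ) := mem_Ksub_sub_two_mul.1 (mem_Csub.1 hC j)
  set c : ℝ := (-1) ^ m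
  have hcc (x : A) : c • c • x = x := neg_one_zpow_smul_smul m x
  have hdd (x : A) : d (d x) = 0 := LinearMap.congr_fun hd x
  have hde' (x : A) : d (e x) = e (d x) := LinearMap.congr_fun hde x
  have hωs (j : ℕ) : d (ω (j + 1)).1 - c • e (ω (j + 1)).2 = c • (ω j).2 := by
    have h := congrArg Prod.fst (congrFun hker (j + 1))
    rw [nabla_apply_succ] at h
    exact sub_eq_zero.1 h
  have next_mem {j : ℕ} {a b : A} (h : d a + c • e b ∈ P (m - 2 * (j : ℤ))) :
      c • ((ω j).1 - (d a + c • e b)) ∈ P (m - 2 * (j : ℤ)) :=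
    smul_mem _ _ (sub_mem (hK j).1 h)
  have main (J L : ℕ) (hJL : J ≤ L) (hL : m < 2 * (L : ℤ)) : ∃ η : ℕ → A × A, ∀ j ≥ J,
      ((η j).1 ∈ P (m - 1 - 2 * (j : ℤ)) ∧
        (η j).2 ∈ Om d P (m - 2 - 2 * (j : ℤ)) ∧ d (η j).2 = (ω j).2 ∧
        d (η j).1 + c • e (η j).2 ∈ P (m - 2 * (j : ℤ))) ∧
      c • ((ω (j + 1)).1 - (d (η (j + 1)).1 + c • e (η (j + 1)).2)) = (η j).2 := by
    induction hJL using Nat.decreasingInduction with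
    | self =>
      have hz (j : ℕ) (hj : j ≥ L) : (ω j).1 = 0 ∧ (ω j).2 = 0 := by
        obtain ⟨h1, h2, -⟩ := hK j
        rw [hPneg _ (by omega), mem_bot] at h1
        rw [hQneg _ (by omega), mem_bot] at h2
        exact ⟨h1, h2⟩
      refine ⟨0, fun j hj => ?_⟩
      simp [hz j hj, hz (j + 1) (by omega)]
    | of_succ J hJ ih =>
      obtain ⟨η, hη⟩ := ih
      obtain ⟨⟨-, -, hb, hab⟩, -⟩ := hη (J + 1) le_rfl
      set b := c • ((ω (J + 1)).1 - (d (η (J + 1)).1 + c • e (η (J + 1)).2)) with hbdef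
      have hdb : d b = (ω J).2 := by
        rw [hbdef, map_smul, map_sub, map_add, hdd, zero_add, map_smul, hde', hb, hωs, hcc]
      have hbOm : b ∈ Om d P (m - 2 - 2 * (J : ℤ)) := by
        refine mem_inf.2 ⟨?_, mem_comap.2 ?_⟩
        · have hbP : b ∈ P (m - 2 * ((J + 1 : ℕ) : ℤ)) := next_mem hab
          convert hbP using 2
          push_cast
          ring
        · rw [hdb]
          convert hQP _ (hK J).2.1 using 2
          ring
      obtain ⟨a, ha, hab'⟩ := exists_correction hOG hbOm
      refine ⟨Function.update η J (a, b), fun j hj => ?_⟩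
      rcases hj.eq_or_lt with rfl | hlt
      · rw [Function.update_self, Function.update_of_ne (by omega)]
        refine ⟨⟨?_, hbOm, hdb, ?_⟩, rfl⟩
        · convert ha using 2
          ring
        · rw [neg_one_zpow_sub_two_mul] at hab'
          have h2 : (-1 : ℝ) ^ (m - 2) = c := by simpa using neg_one_zpow_sub_two_mul m 1
          rw [h2] at hab'
          convert hab' using 2
          ring
      · rw [Function.update_of_ne (by omega), Function.update_of_ne (by omega)]
        exact hη j hlt
  obtain ⟨η, hη⟩ := main 0 (m.toNat + 1) (Nat.zero_le _) (by omega)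
  have hc1 : (-1 : ℝ) ^ (m - 1) = -c := neg_one_zpow_sub_one m
  refine ⟨η, mem_Csub.2 fun j => mem_Ksub_sub_two_mul.2 ?_, funext fun j => ?_⟩
  · obtain ⟨⟨ha, hb, hdb, hab⟩, -⟩ := hη j (Nat.zero_le j)
    rw [hc1, neg_smul, sub_neg_eq_add, hdb]
    refine ⟨ha, ?_, ?_, ?_⟩
    · have hbQ : (η j).2 ∈ Q (m - 2 - 2 * (j : ℤ)) := (hOG _ hb).1.1
      convert hbQ using 2
      ring
    · convert (hK j).2.1 using 2
      ring
    · convert hab using 2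
      ring
  · cases j with
    | zero =>
      obtain ⟨⟨-, -, hdb, hab⟩, -⟩ := hη 0 le_rfl
      have h := next_mem hab
      rw [Nat.cast_zero, mul_zero, sub_zero, hm, mem_bot] at h
      have h' := hcc ((ω 0).1 - (d (η 0).1 + c • e (η 0).2))
      rw [h, smul_zero] at h'
      rw [nabla_apply_zero, hc1, neg_smul, sub_neg_eq_add, hdb, ← sub_eq_zero.1 h'.symm]
    | succ j =>
      have hdb := (hη (j + 1) (Nat.zero_le _)).1.2.2.1
      rw [nabla_apply_succ, hc1, neg_smul, neg_smul, sub_neg_eq_add, sub_neg_eq_add, hdb,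
        ← (hη j (Nat.zero_le j)).2, hcc, add_sub_cancel]

/-- suppose `A^n = 0` for all `n > N` (encoded by the vanishing of the
graded subspaces `P`, `Q` above degree `N`), and suppose `Ω^n ⊆ G^n` for every `n`
(i.e. `G = Ω`, a free action).  Then the localization of the equivariant cohomology
vanishes: `H^*(C) ⊗_ℝ[u] ℝ(u) = 0`.  Since `ℝ(u)` is the field of fractions of
`ℝ[u]` and `H^*(C)` is a graded `ℝ[u]`-module (with `u` acting by the shift
`u·((α,β)⊗u^j) = (α,β)⊗u^(j+1)`), this is equivalent to every cohomology class being
annihilated by a power of `u`: for every cocycle `ω` of degree `m` there is a `k`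
with `u^k·ω` a coboundary, which is the form in which we state it. -/
theorem statement_18 {A : Type*} [AddCommGroup A] [Module ℝ A]
    (d e : A →ₗ[ℝ] A) (hd : d ∘ₗ d = 0) (hde : d ∘ₗ e = e ∘ₗ d)
    (P Q : ℤ → Submodule ℝ A) (hQP : ∀ n, Q n ≤ P n)
    (hPneg : ∀ n : ℤ, n < 0 → P n = ⊥) (hQneg : ∀ n : ℤ, n < 0 → Q n = ⊥)
    (N : ℤ) (hPbdd : ∀ n : ℤ, N < n → P n = ⊥) (hQbdd : ∀ n : ℤ, N < n → Q n = ⊥)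
    (hOG : ∀ n : ℤ, Om d P n ≤ Gsub d e P Q n) :
    ∀ (m : ℤ) (ω : ℕ → A × A), ω ∈ ZC d e P Q m →
      ∃ k : ℕ, (shiftL (A × A))^[k] ω ∈ BC d e P Q (m + 2 * (k : ℤ)) := by
  intro m ω hω
  obtain ⟨k, hk⟩ : ∃ k : ℕ, N < m + 2 * (k : ℤ) := ⟨(N - m).toNat + 1, by omega⟩
  exact ⟨k, ZC_le_BC_of_eq_bot hd hde hQP hPneg hQneg hOG (hPbdd _ hk)
    (iterate_shiftL_mem_ZC hω k)⟩

end IG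

end
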